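/- Let G be a finite simple graph, let s ≥ 1 be an integer, and let (B_i)_{i∈I} be a finite family of nonempty vertex sets, each of which is s-connected in G. Suppose the auxiliary graph on the index set I, in which distinct i and j are adjacent whenever dist_G(B_i, B_j) ≤ 1, is connected. Then the union ∪_{i∈I} B_i is s-connected in G. -/

import Mathlib

open scoped ENNReal

/-- `sdist G A B` is the minimum shortest-path distance (in `ℕ∞`) between the
vertex sets `A` and `B` in the graph `G`. -/
noncomputable def sdist {V : Type*} (G : SimpleGraph V) (A B : Set V) : ℕ∞ :=
  ⨅ a ∈ A, ⨅ b ∈ B, G.edist a b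

/-- A vertex set `S` is `s`-connected in `G` if every nonempty proper subset `S' ⊊ S`
satisfies `dist_G(S', S \ S') ≤ s`. -/
def sConnected {V : Type*} (G : SimpleGraph V) (s : ℕ) (S : Set V) : Prop :=
  ∀ S' ⊆ S, S'.Nonempty → S' ≠ S → sdist G S' (S \ S') ≤ (s : ℕ∞)

/-- The distance between vertex sets is antitone in both sets. -/
theorem sdist_anti {V : Type*} (G : SimpleGraph V) {A A' B B' : Set V}
    (hA : A ⊆ A') (hB : B ⊆ B') : sdist G A' B' ≤ sdist G A B :=
  le_iInf₂ fun a ha => le_iInf₂ fun b hb =>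
    (iInf₂_le a (hA ha)).trans (iInf₂_le b (hB hb))

/-- **Union of `s`-connected sets along a connected auxiliary graph is `s`-connected.**
If `(B_i)_{i∈I}` is a finite family of nonempty `s`-connected vertex sets of `G` and the
auxiliary graph on `I` (distinct `i, j` adjacent iff `dist_G(B_i, B_j) ≤ 1`) is connected,
then `⋃ i, B_i` is `s`-connected in `G`. -/
theorem union_sConnected {V ι : Type*} [Fintype V] [Fintype ι]
    (G : SimpleGraph V) (s : ℕ) (hs : 1 ≤ s)
    (B : ι → Set V) (hne : ∀ i, (B i).Nonempty)
    (hconn : ∀ i, sConnected G s (B i))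
    (𝓑 : SimpleGraph ι)
    (h𝓑 : ∀ i j : ι, 𝓑.Adj i j ↔ i ≠ j ∧ sdist G (B i) (B j) ≤ (1 : ℕ∞))
    (h𝓑conn : 𝓑.Connected) :
    sConnected G s (⋃ i, B i) := by
  intro S' hS' hS'ne hS'proper
  by_cases hsplit : ∃ i, (B i ∩ S').Nonempty ∧ ¬ B i ⊆ S'
  · obtain ⟨i, hmeet, hnot⟩ := hsplit
    refine le_trans (sdist_anti G Set.inter_subset_right ?_)
      (hconn i (B i ∩ S') Set.inter_subset_left hmeet fun h => hnot (Set.inter_eq_left.mp h))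
    exact fun x hx => ⟨Set.mem_iUnion.mpr ⟨i, hx.1⟩, fun h => hx.2 ⟨hx.1, h⟩⟩
  · push Not at hsplit
    obtain ⟨x, hx⟩ := hS'ne
    obtain ⟨i, hi⟩ := Set.mem_iUnion.mp (hS' hx)
    obtain ⟨y, hyU, hy⟩ := Set.exists_of_ssubset (hS'.ssubset_of_ne hS'proper)
    obtain ⟨j, hj⟩ := Set.mem_iUnion.mp hyU
    obtain ⟨p⟩ := h𝓑conn.preconnected i j
    obtain ⟨d, -, hd₁, hd₂⟩ := p.exists_boundary_dart {k | B k ⊆ S'}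
      (hsplit i ⟨x, hi, hx⟩) (fun h => hy (h hj))
    have hsub : B d.snd ⊆ (⋃ i, B i) \ S' := fun z hz =>
      ⟨Set.mem_iUnion.mpr ⟨_, hz⟩, fun h => hd₂ (hsplit _ ⟨z, hz, h⟩)⟩
    calc sdist G S' ((⋃ i, B i) \ S') ≤ sdist G (B d.fst) (B d.snd) := sdist_anti G hd₁ hsub
      _ ≤ 1 := ((h𝓑 _ _).mp d.adj).2
      _ ≤ s := by exact_mod_cast hs
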